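/- arXiv:2109.02195 — 2 statements merged into one kernel-verified Lean document; each statement's English description precedes it below -/
import Mathlib

section
/- (Multivariate Faà di Bruno formula) Let g : ℝ³ → ℝ be smooth in a neighborhood of x₀ ∈ ℝ³, let h : ℝ → ℝ be smooth in a neighborhood of y₀ = g(x₀), and set f(x) = h(g(x)). Then for every multi-index β ∈ ℕ₀³ with |β| ≥ 1, ∂^β f(x₀) = Σ_{i=1}^{|β|} h^{(i)}(y₀) Σ_{s=1}^{|β|} Σ_{P_s(i,β)} β! ∏_{l=1}^s (∂^{λ_l} g(x₀))^{k_l} / (k_l! (λ_l!)^{k_l}). -/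
open MeasureTheory Finset

noncomputable section

/-- Points of `ℝ³`. -/
abbrev Vec3 := Fin 3 → ℝ

/-- Multi-indices in `ℕ₀³`. -/
abbrev MIdx := Fin 3 → ℕ

/-- Total degree `|α|` of a multi-index. -/
def wt (α : MIdx) : ℕ := ∑ i, α i

/-- Multi-index factorial `α! = α₁!α₂!α₃!`. -/
def mfact (α : MIdx) : ℕ := ∏ i, Nat.factorial (α i)

variable {E : Type*} [NormedAddCommGroup E] [NormedSpace ℝ E]

/-- Partial derivative `∂_i`. -/
def pd (i : Fin 3) (f : Vec3 → E) : Vec3 → E :=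
  fun x => fderiv ℝ f x (Pi.single i 1)

/-- Iterated partial derivative `∂^α`. -/
def pda (α : MIdx) (f : Vec3 → E) : Vec3 → E :=
  (pd 0)^[α 0] ((pd 1)^[α 1] ((pd 2)^[α 2] f))

/-- The `L²(ℝ³)` norm. -/
def l2 (f : Vec3 → E) : ℝ := (eLpNorm f 2 volume).toReal

/-- The summand family of the analytic norm `‖·‖_{A(τ)}`
(with the convention `n! = 1` for `n < 0`, realized by truncated subtraction). -/
def AFam (τ : ℝ) (u : Vec3 → E) : MIdx → ℝ :=
  fun α => τ ^ wt α / (Nat.factorial (wt α - 3)) * l2 (pda α u)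

/-- The analytic norm `‖u‖_{A(τ)} = Σ_m Σ_{|α|=m} (τ^m/(m-3)!) ‖∂^α u‖_{L²}`. -/
def anorm (τ : ℝ) (u : Vec3 → E) : ℝ := ∑' α : MIdx, AFam τ u α

/-- The summand family of the dissipative analytic norm `‖·‖_{Ã(τ)}`. -/
def DFam (τ : ℝ) (u : Vec3 → E) : MIdx → ℝ :=
  fun α => (wt α) * τ ^ (wt α - 1) / (Nat.factorial (wt α - 3)) * l2 (pda α u)

/-- The dissipative analytic norm `‖u‖_{Ã(τ)} = Σ_{m≥1} Σ_{|α|=m} (m τ^{m-1}/(m-3)!) ‖∂^α u‖_{L²}`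
(the `m = 0` term vanishes since it carries the factor `m`). -/
def danorm (τ : ℝ) (u : Vec3 → E) : ℝ := ∑' α : MIdx, DFam τ u α

/-- Time derivative `∂_t` of a time-dependent function. -/
def tderiv (f : ℝ → Vec3 → E) : ℝ → Vec3 → E := fun t x => deriv (fun s => f s x) t

/-- The pair `u = (p, v)`. -/
def pairF (p : Vec3 → ℝ) (v : Vec3 → Vec3) : Vec3 → ℝ × Vec3 := fun x => (p x, v x)

/-- `(p, v)` solves the symmetrized isentropic Euler system
`E(εu)(∂_t u + v·∇u) + (1/ε) L(∂_x) u = 0` on `[0, T]`, componentwise: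
`a(εp)(∂_t p + v·∇p) + (1/ε) div v = 0` and `r(εp)(∂_t v + v·∇v) + (1/ε) ∇p = 0`. -/
def IsEulerSol (a r : ℝ → ℝ) (ε : ℝ) (p : ℝ → Vec3 → ℝ) (v : ℝ → Vec3 → Vec3)
    (T : ℝ) : Prop :=
  ∀ t ∈ Set.Icc (0:ℝ) T, ∀ x : Vec3,
    (a (ε * p t x) * (tderiv p t x + ∑ i, v t x i * pd i (p t) x)
      + (1/ε) * ∑ i, pd i (fun y => v t y i) x = 0)
    ∧ ∀ j, r (ε * p t x) * (tderiv v t x j + ∑ i, v t x i * pd i (fun y => v t y j) x)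
      + (1/ε) * pd j (p t) x = 0

/-- Smoothness of a time dependent pair `(p, v)` in space and time. -/
def Smooth2 (p : ℝ → Vec3 → ℝ) (v : ℝ → Vec3 → Vec3) : Prop :=
  (∀ t, ContDiff ℝ (⊤ : ℕ∞) (p t)) ∧ (∀ t, ContDiff ℝ (⊤ : ℕ∞) (v t)) ∧
  (∀ x, ContDiff ℝ (⊤ : ℕ∞) (fun t => p t x)) ∧ (∀ x, ContDiff ℝ (⊤ : ℕ∞) (fun t => v t x))

/-- The initial data bound `Σ_m Σ_{|α|=m} (τ₀^m/(m−3)!) ‖∂^α u₀‖_{L²} ≤ M₀`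
(finiteness of the sum included). -/
def InitBound (τ₀ M₀ : ℝ) (u₀ : Vec3 → ℝ × Vec3) : Prop :=
  Summable (AFam τ₀ u₀) ∧ anorm τ₀ u₀ ≤ M₀

/-- The linear order `α ≺ β` on multi-indices: `|α| < |β|`, or `|α| = |β|`
and `α` precedes `β` lexicographically. -/
def mlt (α β : MIdx) : Prop :=
  wt α < wt β ∨ (wt α = wt β ∧ ∃ k : Fin 3, (∀ j, j < k → α j = β j) ∧ α k < β k)

/-- The index set `P_s(i, β)` of the multivariate Faà di Bruno formula: tuples
`(k₁,…,k_s; λ₁,…,λ_s)` with `k_l ∈ ℕ`, `λ_l ∈ ℕ₀³`, `0 ≺ λ₁ ≺ ⋯ ≺ λ_s`,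
`Σ k_l = i` and `Σ k_l λ_l = β`. -/
def Pset (s i : ℕ) (β : MIdx) : Set ((Fin s → ℕ) × (Fin s → MIdx)) :=
  {kl | (∀ l, 0 < kl.1 l) ∧ (∀ l, mlt 0 (kl.2 l)) ∧
    (∀ l l', l < l' → mlt (kl.2 l) (kl.2 l')) ∧
    (∑ l, kl.1 l = i) ∧ (∑ l, kl.1 l • kl.2 l = β)}

/-- The operator `w ↦ E(εu)⁻¹ L(∂_x) w = (a(εp)⁻¹ div w₂, r(εp)⁻¹ ∇w₁)`. -/
def EinvL (a r : ℝ → ℝ) (ε : ℝ) (p : Vec3 → ℝ) (w : Vec3 → ℝ × Vec3) :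
    Vec3 → ℝ × Vec3 :=
  fun x => ((a (ε * p x))⁻¹ * ∑ i, pd i (fun y => (w y).2 i) x,
            fun j => (r (ε * p x))⁻¹ * pd j (fun y => (w y).1) x)

section PartialDerivatives

variable {x₀ : Vec3} {u v : Vec3 → ℝ}

lemma contDiffAt_pd (hu : ContDiffAt ℝ (⊤ : ℕ∞) u x₀) (i : Fin 3) :
    ContDiffAt ℝ (⊤ : ℕ∞) (pd i u) x₀ :=
  (hu.fderiv_right (m := (⊤ : ℕ∞)) (by simp)).clm_apply contDiffAt_const

lemma contDiffAt_iterate_pd (hu : ContDiffAt ℝ (⊤ : ℕ∞) u x₀) (i : Fin 3) (n : ℕ) :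
    ContDiffAt ℝ (⊤ : ℕ∞) ((pd i)^[n] u) x₀ := by
  induction n with
  | zero => exact hu
  | succ n ih => rw [Function.iterate_succ_apply']; exact contDiffAt_pd ih i

lemma pd_congr (h : u =ᶠ[nhds x₀] v) (i : Fin 3) : pd i u =ᶠ[nhds x₀] pd i v := by
  filter_upwards [h.fderiv (𝕜 := ℝ)] with x hx
  simp only [pd, hx]

lemma iterate_pd_congr (h : u =ᶠ[nhds x₀] v) (i : Fin 3) (n : ℕ) :
    (pd i)^[n] u =ᶠ[nhds x₀] (pd i)^[n] v := by
  induction n with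
  | zero => exact h
  | succ n ih => simp only [Function.iterate_succ_apply']; exact pd_congr ih i

lemma pda_congr (h : u =ᶠ[nhds x₀] v) (α : MIdx) : pda α u =ᶠ[nhds x₀] pda α v :=
  iterate_pd_congr (iterate_pd_congr (iterate_pd_congr h _ _) _ _) _ _

lemma pd_comm (hu : ContDiffAt ℝ (⊤ : ℕ∞) u x₀) (i j : Fin 3) :
    pd i (pd j u) =ᶠ[nhds x₀] pd j (pd i u) := by
  have h2 : ContDiffAt ℝ 2 u x₀ := hu.of_le (WithTop.coe_le_coe.2 le_top)
  filter_upwards [h2.eventually (by simp)] with x hx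
  have hd : DifferentiableAt ℝ (fderiv ℝ u) x :=
    (hx.fderiv_right (m := 1) (by norm_num)).differentiableAt (by norm_num)
  have hs := hx.isSymmSndFDerivAt (by simp)
  have key : ∀ a b : Fin 3, pd a (pd b u) x =
      fderiv ℝ (fderiv ℝ u) x (Pi.single a 1) (Pi.single b 1) := by
    intro a b
    have := hd.hasFDerivAt.clm_apply (hasFDerivAt_const (Pi.single b (1 : ℝ) : Vec3) x)
    unfold pd
    rw [this.fderiv]
    simp
  rw [key, key]
  exact hs _ _

lemma iterate_pd_comm (hu : ContDiffAt ℝ (⊤ : ℕ∞) u x₀) (i j : Fin 3) (n : ℕ) :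
    pd j ((pd i)^[n] u) =ᶠ[nhds x₀] (pd i)^[n] (pd j u) := by
  induction n with
  | zero => rfl
  | succ n ih =>
    simp only [Function.iterate_succ_apply']
    exact (pd_comm (contDiffAt_iterate_pd hu i n) j i).trans (pd_congr ih i)

lemma pda_add_single (hu : ContDiffAt ℝ (⊤ : ℕ∞) u x₀) (α : MIdx) (j : Fin 3) :
    pda (α + Pi.single j 1) u =ᶠ[nhds x₀] pda α (pd j u) := by
  have h2 := contDiffAt_iterate_pd hu 2 (α 2)
  have h1 := contDiffAt_iterate_pd h2 1 (α 1)
  fin_cases j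
  · simp only [pda, Pi.add_apply]
    simp only [Fin.zero_eta, Pi.single_eq_same, Function.iterate_succ_apply]
    simpa using iterate_pd_congr ((iterate_pd_comm h2 1 0 (α 1)).trans
      (iterate_pd_congr (iterate_pd_comm hu 2 0 (α 2)) 1 (α 1))) 0 (α 0)
  · simp only [pda, Pi.add_apply]
    simpa using iterate_pd_congr
      (iterate_pd_congr (iterate_pd_comm hu 2 1 (α 2)) 1 (α 1)) 0 (α 0)
  · simp only [pda, Pi.add_apply]
    simp

lemma pd_mul (hu : ContDiffAt ℝ (⊤ : ℕ∞) u x₀) (hv : ContDiffAt ℝ (⊤ : ℕ∞) v x₀) (i : Fin 3) :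
    pd i (fun x => u x * v x) =ᶠ[nhds x₀] fun x => pd i u x * v x + u x * pd i v x := by
  have hu1 : ContDiffAt ℝ 1 u x₀ := hu.of_le (by exact_mod_cast le_top)
  have hv1 : ContDiffAt ℝ 1 v x₀ := hv.of_le (by exact_mod_cast le_top)
  filter_upwards [hu1.eventually (by simp), hv1.eventually (by simp)] with x hux hvx
  unfold pd
  rw [fderiv_fun_mul (hux.differentiableAt (by simp)) (hvx.differentiableAt (by simp))]
  simp
  ring

lemma pd_comp {h : ℝ → ℝ} (hu : ContDiffAt ℝ (⊤ : ℕ∞) u x₀)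
    (hh : ContDiffAt ℝ (⊤ : ℕ∞) h (u x₀)) (i : Fin 3) :
    pd i (fun x => h (u x)) =ᶠ[nhds x₀] fun x => deriv h (u x) * pd i u x := by
  have hu1 : ContDiffAt ℝ 1 u x₀ := hu.of_le (by exact_mod_cast le_top)
  have hh1 : ContDiffAt ℝ 1 h (u x₀) := hh.of_le (by exact_mod_cast le_top)
  filter_upwards [hu1.eventually (by simp),
    hu.continuousAt.eventually (hh1.eventually (by simp))] with x hux hhx
  have hd := (hhx.differentiableAt (by simp)).hasDerivAt.comp_hasFDerivAt x
    (hux.differentiableAt (by simp)).hasFDerivAt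
  have hd' : fderiv ℝ (fun x => h (u x)) x = deriv h (u x) • fderiv ℝ u x := hd.fderiv
  simp [pd, hd']

lemma pd_add (hu : ContDiffAt ℝ (⊤ : ℕ∞) u x₀) (hv : ContDiffAt ℝ (⊤ : ℕ∞) v x₀) (i : Fin 3) :
    pd i (fun x => u x + v x) =ᶠ[nhds x₀] fun x => pd i u x + pd i v x := by
  have hu1 : ContDiffAt ℝ 1 u x₀ := hu.of_le (by exact_mod_cast le_top)
  have hv1 : ContDiffAt ℝ 1 v x₀ := hv.of_le (by exact_mod_cast le_top)
  filter_upwards [hu1.eventually (by simp), hv1.eventually (by simp)] with x hux hvx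
  unfold pd
  rw [fderiv_fun_add (hux.differentiableAt (by simp)) (hvx.differentiableAt (by simp))]
  simp

end PartialDerivatives

lemma wt_add_single (α : MIdx) (j : Fin 3) : wt (α + Pi.single j 1) = wt α + 1 := by
  simp [wt, Finset.sum_add_distrib]

lemma mfact_add_single (α : MIdx) (j : Fin 3) :
    mfact (α + Pi.single j 1) = (α j + 1) * mfact α := by
  fin_cases j <;> simp [mfact, Fin.prod_univ_three, Nat.factorial_succ] <;> ring

lemma mfact_ne_zero (α : MIdx) : (mfact α : ℝ) ≠ 0 := by
  simp [mfact, Finset.prod_eq_zero_iff, Nat.factorial_ne_zero]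

lemma wt_eq_zero {α : MIdx} : wt α = 0 ↔ α = 0 := by
  simp [wt, funext_iff]

/-- The polynomial `P` has the same Taylor coefficients of degree at most `n` as `u` has
at `x₀`. -/
def IsTaylorPoly (x₀ : Vec3) (n : ℕ) (u : Vec3 → ℝ) (P : MvPolynomial (Fin 3) ℝ) : Prop :=
  ∀ α : Fin 3 →₀ ℕ, wt α ≤ n → pda α u x₀ = mfact α * P.coeff α

namespace IsTaylorPoly

variable {x₀ : Vec3} {n : ℕ} {u v : Vec3 → ℝ} {P Q : MvPolynomial (Fin 3) ℝ}

lemma mono {m : ℕ} (h : IsTaylorPoly x₀ n u P) (hm : m ≤ n) : IsTaylorPoly x₀ m u P :=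
  fun α hα => h α (hα.trans hm)

lemma congr (h : IsTaylorPoly x₀ n u P) (huv : v =ᶠ[nhds x₀] u) : IsTaylorPoly x₀ n v P :=
  fun α hα => (pda_congr huv α).eq_of_nhds.trans (h α hα)

lemma zero_iff : IsTaylorPoly x₀ 0 u P ↔ u x₀ = P.coeff 0 := by
  constructor
  · intro h
    simpa [pda, mfact] using h 0 (by simp [wt])
  · intro h α hα
    obtain rfl : α = 0 := DFunLike.coe_injective (wt_eq_zero.1 (Nat.le_zero.1 hα))
    simpa [pda, mfact] using h

lemma succ_iff (hu : ContDiffAt ℝ (⊤ : ℕ∞) u x₀) :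
    IsTaylorPoly x₀ (n + 1) u P ↔
      u x₀ = P.coeff 0 ∧ ∀ j, IsTaylorPoly x₀ n (pd j u) (MvPolynomial.pderiv j P) := by
  have key (α : Fin 3 →₀ ℕ) (j : Fin 3) :
      pda (α + Finsupp.single j 1 : Fin 3 →₀ ℕ) u x₀
          = mfact (α + Finsupp.single j 1 : Fin 3 →₀ ℕ) * P.coeff (α + Finsupp.single j 1) ↔
        pda α (pd j u) x₀ = mfact α * (MvPolynomial.pderiv j P).coeff α := by
    rw [Finsupp.coe_add, Finsupp.single_eq_pi_single, (pda_add_single hu α j).eq_of_nhds,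
      mfact_add_single, MvPolynomial.coeff_pderiv]
    push_cast
    constructor <;> intro h <;> rw [h] <;> ring
  constructor
  · intro h
    refine ⟨zero_iff.1 (h.mono (Nat.zero_le _)), fun j α hα => (key α j).1 (h _ ?_)⟩
    rw [Finsupp.coe_add, Finsupp.single_eq_pi_single, wt_add_single]
    omega
  · rintro ⟨h0, h⟩ α hα
    by_cases hα0 : α = 0
    · subst hα0
      exact zero_iff.2 h0 0 (by simp [wt])
    · obtain ⟨j, hj⟩ := Finsupp.ne_iff.1 hα0
      have hle : Finsupp.single j 1 ≤ α := by
        rw [Finsupp.single_le_iff]; exact Nat.one_le_iff_ne_zero.2 hj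
      obtain ⟨γ, rfl⟩ := exists_add_of_le hle
      rw [add_comm] at hα ⊢
      rw [Finsupp.coe_add, Finsupp.single_eq_pi_single, wt_add_single] at hα
      exact (key γ j).2 (h j γ (by omega))

lemma add (hu : ContDiffAt ℝ (⊤ : ℕ∞) u x₀) (hv : ContDiffAt ℝ (⊤ : ℕ∞) v x₀)
    (hP : IsTaylorPoly x₀ n u P) (hQ : IsTaylorPoly x₀ n v Q) :
    IsTaylorPoly x₀ n (fun x => u x + v x) (P + Q) := by
  induction n generalizing u v P Q with
  | zero => rw [zero_iff] at *; simp [hP, hQ]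
  | succ n ih =>
    rw [succ_iff hu] at hP
    rw [succ_iff hv] at hQ
    refine (succ_iff (hu.add hv)).2 ⟨by simp [hP.1, hQ.1], fun j => ?_⟩
    rw [map_add]
    exact (ih (contDiffAt_pd hu j) (contDiffAt_pd hv j) (hP.2 j) (hQ.2 j)).congr (pd_add hu hv j)

lemma mul (hu : ContDiffAt ℝ (⊤ : ℕ∞) u x₀) (hv : ContDiffAt ℝ (⊤ : ℕ∞) v x₀)
    (hP : IsTaylorPoly x₀ n u P) (hQ : IsTaylorPoly x₀ n v Q) :
    IsTaylorPoly x₀ n (fun x => u x * v x) (P * Q) := by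
  induction n generalizing u v P Q with
  | zero =>
    rw [zero_iff] at *
    simp only [hP, hQ, ← MvPolynomial.constantCoeff_eq, map_mul]
  | succ n ih =>
    have hPn := hP.mono (Nat.le_succ n)
    have hQn := hQ.mono (Nat.le_succ n)
    rw [succ_iff hu] at hP
    rw [succ_iff hv] at hQ
    refine (succ_iff (hu.mul hv)).2 ⟨?_, fun j => ?_⟩
    · simp only [hP.1, hQ.1, ← MvPolynomial.constantCoeff_eq, map_mul]
    have hu' := contDiffAt_pd hu j
    have hv' := contDiffAt_pd hv j
    rw [MvPolynomial.pderiv_mul]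
    exact ((ih hu' hv (hP.2 j) hQn).add (hu'.mul hv) (hu.mul hv') (ih hu hv' hPn (hQ.2 j))).congr
      (pd_mul hu hv j)

/-- Composition of Taylor polynomials: `P` is the Taylor polynomial of the inner function,
without its constant term. -/
lemma comp {h : ℝ → ℝ} (hu : ContDiffAt ℝ (⊤ : ℕ∞) u x₀)
    (hh : ContDiffAt ℝ (⊤ : ℕ∞) h (u x₀)) (hP0 : P.coeff 0 = 0)
    (hP : IsTaylorPoly x₀ n u (MvPolynomial.C (u x₀) + P)) :
    IsTaylorPoly x₀ n (fun x => h (u x))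
      (∑ i ∈ range (n + 1),
        MvPolynomial.C (iteratedDeriv i h (u x₀) / (i.factorial : ℝ)) * P ^ i) := by
  have hconst (h : ℝ → ℝ) (n : ℕ) : h (u x₀) = (∑ i ∈ range (n + 1),
      MvPolynomial.C (iteratedDeriv i h (u x₀) / (i.factorial : ℝ)) * P ^ i).coeff 0 := by
    rw [← MvPolynomial.constantCoeff_eq] at hP0 ⊢
    rw [map_sum, Finset.sum_range_succ']
    simp [hP0]
  induction n generalizing h with
  | zero => exact zero_iff.2 (hconst h 0)
  | succ n ih =>
    have hh' : ContDiffAt ℝ (⊤ : ℕ∞) (deriv h) (u x₀) :=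
      (hh.fderiv_right (m := (⊤ : ℕ∞)) (by simp)).clm_apply contDiffAt_const
    refine (succ_iff (hh.comp x₀ hu)).2 ⟨hconst h (n + 1), fun j => ?_⟩
    have hrec := ih hh' (hP.mono (Nat.le_succ n))
    have hPj := ((succ_iff hu).1 hP).2 j
    rw [map_add, MvPolynomial.pderiv_C, zero_add] at hPj
    have hmul := (hrec.mul (hh'.comp x₀ hu) (contDiffAt_pd hu j) hPj).congr (pd_comp hu hh j)
    change IsTaylorPoly x₀ n (pd j fun x => h (u x)) _
    convert hmul using 1
    rw [map_sum, Finset.sum_range_succ', Finset.sum_mul]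
    simp only [pow_zero, mul_one, MvPolynomial.pderiv_C, add_zero]
    refine Finset.sum_congr rfl fun i _ => ?_
    have hc : (iteratedDeriv (i + 1) h (u x₀) / ((i + 1).factorial : ℝ)) * ((i + 1 : ℕ) : ℝ)
        = iteratedDeriv i (deriv h) (u x₀) / (i.factorial : ℝ) := by
      rw [iteratedDeriv_succ', Nat.factorial_succ]
      have := Nat.factorial_ne_zero i
      push_cast
      field_simp
    rw [MvPolynomial.pderiv_C_mul, MvPolynomial.pderiv_pow, ← hc, map_mul, map_natCast]
    simp only [Nat.add_sub_cancel]
    ring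

end IsTaylorPoly

section IndexSet

/-- The order `≺` as the pull-back of a lexicographic order. -/
def mkey (α : MIdx) : ℕ ×ₗ Lex (Fin 3 → ℕ) := toLex (wt α, toLex α)

lemma mkey_injective : Function.Injective mkey := by
  intro α β h
  exact congrArg (fun a => ofLex (ofLex a).2) h

lemma mkey_lt_iff {α β : MIdx} : mkey α < mkey β ↔ mlt α β := by
  rw [mkey, mkey, Prod.Lex.lt_iff]
  rfl

lemma zero_mlt_iff {α : MIdx} : mlt 0 α ↔ 0 < wt α := by
  constructor
  · rintro (h | ⟨-, k, -, hk⟩)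
    · exact (Nat.zero_le _).trans_lt h
    · exact hk.trans_le (Finset.single_le_sum (f := α) (fun _ _ => Nat.zero_le _) (mem_univ k))
  · intro h
    exact Or.inl (by simpa [wt] using h)

/-- The multiplicity function `μ ↦ k_l` if `μ = λ_l` (and `0` if `μ` is none of the `λ_l`)
of a tuple `(k; λ)`. -/
def partMult {s : ℕ} (kl : (Fin s → ℕ) × (Fin s → MIdx)) (μ : MIdx) : ℕ :=
  ∑ l, if kl.2 l = μ then kl.1 l else 0

variable {s i : ℕ} {β : MIdx} {kl : (Fin s → ℕ) × (Fin s → MIdx)}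

lemma partMult_apply (hinj : Function.Injective kl.2) (l : Fin s) :
    partMult kl (kl.2 l) = kl.1 l := by
  simp [partMult, hinj.eq_iff]

lemma partMult_ne_zero_iff (hk : ∀ l, 0 < kl.1 l) (μ : MIdx) :
    partMult kl μ ≠ 0 ↔ μ ∈ Set.range kl.2 := by
  simp [partMult, Finset.sum_eq_zero_iff, (hk _).ne']

@[to_additive]
lemma prod_partMult {M : Type*} [CommMonoid M] (hk : ∀ l, 0 < kl.1 l)
    (hinj : Function.Injective kl.2) (Λ : Finset MIdx) (hΛ : ∀ l, kl.2 l ∈ Λ)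
    (F : MIdx → ℕ → M) (hF : ∀ μ, F μ 0 = 1) :
    ∏ μ ∈ Λ, F μ (partMult kl μ) = ∏ l, F (kl.2 l) (kl.1 l) := by
  classical
  rw [← Finset.prod_subset (s₁ := Finset.univ.image kl.2)]
  · rw [Finset.prod_image hinj.injOn]
    exact Finset.prod_congr rfl fun l _ => by rw [partMult_apply hinj]
  · intro μ hμ
    obtain ⟨l, -, rfl⟩ := Finset.mem_image.1 hμ
    exact hΛ l
  · intro μ _ hμ
    have : partMult kl μ = 0 := by
      by_contra hne
      obtain ⟨l, rfl⟩ := (partMult_ne_zero_iff hk μ).1 hne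
      exact hμ (Finset.mem_image_of_mem _ (Finset.mem_univ l))
    rw [this, hF]

lemma Pset.strictMono_mkey (h : kl ∈ Pset s i β) : StrictMono fun l => mkey (kl.2 l) :=
  fun _ _ hl => mkey_lt_iff.2 (h.2.2.1 _ _ hl)

lemma Pset.injective (h : kl ∈ Pset s i β) : Function.Injective kl.2 :=
  Function.Injective.of_comp (f := mkey) (Pset.strictMono_mkey h).injective

lemma wt_mono {α γ : MIdx} (h : α ≤ γ) : wt α ≤ wt γ := Finset.sum_le_sum fun j _ => h j

lemma le_of_sum_smul_eq {ι : Type*} {t : Finset ι} {k : ι → ℕ} {lam : ι → MIdx}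
    (h : ∑ l ∈ t, k l • lam l = β) {l : ι} (hl : l ∈ t) (hk : k l ≠ 0) : lam l ≤ β := by
  rw [← h]
  refine le_trans ?_ (Finset.single_le_sum (f := fun l => k l • lam l) (fun _ _ => zero_le) hl)
  intro j
  simpa using Nat.le_mul_of_pos_left _ (Nat.pos_of_ne_zero hk)

/-- The multi-indices of positive degree at most `N`. -/
def posIdx (N : ℕ) : Finset MIdx := (Finset.Iic fun _ => N).filter fun μ => 0 < wt μ ∧ wt μ ≤ N

lemma mem_posIdx {N : ℕ} {μ : MIdx} : μ ∈ posIdx N ↔ 0 < wt μ ∧ wt μ ≤ N := by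
  simp only [posIdx, Finset.mem_filter, Finset.mem_Iic, and_iff_right_iff_imp]
  exact fun h j => (Finset.single_le_sum (f := μ) (fun _ _ => Nat.zero_le _) (mem_univ j)).trans h.2

/-- The multiplicity functions of total multiplicity `i` and total multi-index `β`. -/
def partMultFns (i : ℕ) (β : MIdx) : Finset (MIdx → ℕ) :=
  ((posIdx (wt β)).piAntidiag i).filter fun k => ∑ μ ∈ posIdx (wt β), k μ • μ = β

/-- The number of multi-indices of positive partMult. -/
def numParts (β : MIdx) (k : MIdx → ℕ) : ℕ := #{μ ∈ posIdx (wt β) | k μ ≠ 0}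

lemma Pset.snd_mem_posIdx (h : kl ∈ Pset s i β) (l : Fin s) : kl.2 l ∈ posIdx (wt β) :=
  mem_posIdx.2 ⟨zero_mlt_iff.1 (h.2.1 l),
    wt_mono (le_of_sum_smul_eq h.2.2.2.2 (mem_univ l) (h.1 l).ne')⟩

lemma Pset.partMult_mem (h : kl ∈ Pset s i β) :
    partMult kl ∈ {k ∈ partMultFns i β | numParts β k = s} := by
  have hinj := Pset.injective h
  have hmem := Pset.snd_mem_posIdx h
  rw [Finset.mem_filter, partMultFns, Finset.mem_filter, Finset.mem_piAntidiag, numParts]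
  refine ⟨⟨⟨?_, fun μ hμ => ?_⟩, ?_⟩, ?_⟩
  · rw [sum_partMult h.1 hinj _ hmem (fun _ n => n) (fun _ => rfl)]
    exact h.2.2.2.1
  · obtain ⟨l, rfl⟩ := (partMult_ne_zero_iff h.1 μ).1 hμ
    exact hmem l
  · rw [sum_partMult h.1 hinj _ hmem (fun μ n => n • μ) (fun _ => zero_smul _ _)]
    exact h.2.2.2.2
  · rw [Finset.card_filter,
      sum_partMult h.1 hinj _ hmem (fun _ n => if n ≠ 0 then 1 else 0) (fun _ => by simp)]
    simp [(h.1 _).ne']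

lemma Pset.partMult_injOn : Set.InjOn partMult (Pset s i β) := by
  rintro ⟨k, lam⟩ h ⟨k', lam'⟩ h' heq
  have hrange : Set.range lam = Set.range lam' := by
    ext μ
    rw [← partMult_ne_zero_iff h.1, ← partMult_ne_zero_iff h'.1, heq]
  have hlam : lam = lam' := by
    have : (fun l => mkey (lam l)) = fun l => mkey (lam' l) := by
      refine ((Pset.strictMono_mkey h).range_inj (Pset.strictMono_mkey h')).1 ?_
      rw [Set.range_comp' mkey, Set.range_comp' mkey, hrange]
    exact funext fun l => mkey_injective (congrFun this l)
  subst hlam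
  have hk : k = k' := funext fun l => by
    exact (partMult_apply (Pset.injective h) l).symm.trans
      ((congrFun heq (lam l)).trans (partMult_apply (Pset.injective h') l))
  rw [hk]

lemma Pset.partMult_surjOn :
    Set.SurjOn partMult (Pset s i β) ↑({k ∈ partMultFns i β | numParts β k = s}) := by
  classical
  intro k hk
  rw [Finset.mem_coe, Finset.mem_filter, partMultFns, Finset.mem_filter, Finset.mem_piAntidiag,
    numParts] at hk
  obtain ⟨⟨⟨hsum, hsupp⟩, hβ⟩, hcard⟩ := hk
  set t := {μ ∈ posIdx (wt β) | k μ ≠ 0}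
  have hcard' : (t.image mkey).card = s := by
    rw [Finset.card_image_of_injective _ mkey_injective, hcard]
  let e := (t.image mkey).orderEmbOfFin hcard'
  have he (l : Fin s) : ∃ μ ∈ t, mkey μ = e l :=
    Finset.mem_image.1 (Finset.orderEmbOfFin_mem _ hcard' l)
  choose lam hlam hkey using he
  have hpos (l : Fin s) : 0 < k (lam l) := Nat.pos_of_ne_zero (Finset.mem_filter.1 (hlam l)).2
  have hmem (l : Fin s) : lam l ∈ posIdx (wt β) := (Finset.mem_filter.1 (hlam l)).1
  have hmono {l l' : Fin s} (h : l < l') : mlt (lam l) (lam l') := by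
    rw [← mkey_lt_iff, hkey, hkey]
    exact e.strictMono h
  have hinj : Function.Injective lam := fun l l' h => e.injective (by rw [← hkey, ← hkey, h])
  have hmult : partMult (fun l => k (lam l), lam) = k := by
    funext μ
    by_cases hμ : k μ = 0
    · rw [hμ]
      by_contra hne
      obtain ⟨l, rfl⟩ := (partMult_ne_zero_iff (kl := (fun l => k (lam l), lam)) hpos μ).1 hne
      exact (hpos l).ne' hμ
    · have hμt : mkey μ ∈ Set.range e := by
        rw [Finset.range_orderEmbOfFin]
        exact Finset.mem_coe.2 (Finset.mem_image_of_mem _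
          (Finset.mem_filter.2 ⟨hsupp μ hμ, hμ⟩))
      obtain ⟨l, hl⟩ := hμt
      obtain rfl : lam l = μ := mkey_injective ((hkey l).trans hl)
      exact partMult_apply (kl := (fun l => k (lam l), lam)) hinj l
  refine ⟨(fun l => k (lam l), lam), ⟨hpos, fun l => ?_, fun _ _ => hmono, ?_, ?_⟩, hmult⟩
  · exact zero_mlt_iff.2 (mem_posIdx.1 (hmem l)).1
  · have := sum_partMult (kl := (fun l => k (lam l), lam)) hpos hinj _ hmem (fun _ n => n)
      (fun _ => rfl)
    rwa [hmult, hsum, eq_comm] at this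
  · have := sum_partMult (kl := (fun l => k (lam l), lam)) hpos hinj _ hmem (fun μ n => n • μ)
      (fun _ => zero_smul _ _)
    rwa [hmult, hβ, eq_comm] at this

lemma tsum_Pset (W : MIdx → ℕ → ℝ) (hW : ∀ μ, W μ 0 = 1) :
    ∑' kl : Pset s i β, ∏ l, W (kl.1.2 l) (kl.1.1 l) =
      ∑ k ∈ partMultFns i β with numParts β k = s, ∏ μ ∈ posIdx (wt β), W μ (k μ) := by
  have hbij : Set.BijOn partMult (Pset s i β)
      ↑({k ∈ partMultFns i β | numParts β k = s}) :=
    ⟨fun _ h => Pset.partMult_mem h, Pset.partMult_injOn, Pset.partMult_surjOn⟩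
  rw [← Finset.tsum_subtype', ← (hbij.equiv partMult).tsum_eq]
  refine tsum_congr fun kl => ?_
  exact (prod_partMult kl.2.1 (Pset.injective kl.2) _ (Pset.snd_mem_posIdx kl.2) W hW).symm

lemma numParts_mem_Icc (hi : 1 ≤ i) {k : MIdx → ℕ} (hk : k ∈ partMultFns i β) :
    numParts β k ∈ Finset.Icc 1 (wt β) := by
  simp only [partMultFns, Finset.mem_filter, Finset.mem_piAntidiag] at hk
  obtain ⟨⟨hsum, hsupp⟩, hβ⟩ := hk
  rw [Finset.mem_Icc]
  constructor
  · rw [Nat.one_le_iff_ne_zero]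
    intro h0
    rw [numParts, Finset.card_eq_zero, Finset.filter_eq_empty_iff] at h0
    rw [Finset.sum_eq_zero fun μ hμ => not_not.1 (h0 hμ)] at hsum
    omega
  · have hwt : wt β = ∑ μ ∈ posIdx (wt β), k μ * wt μ := by
      conv_lhs => rw [← hβ]
      simp only [wt, Finset.sum_apply, Pi.smul_apply, smul_eq_mul, Finset.mul_sum]
      exact Finset.sum_comm
    rw [numParts, Finset.card_filter]
    refine (Finset.sum_le_sum fun μ hμ => ?_).trans hwt.ge
    split_ifs with h
    · exact Nat.mul_pos (Nat.pos_of_ne_zero h) (mem_posIdx.1 hμ).1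
    · exact Nat.zero_le _

lemma sum_tsum_Pset (hi : 1 ≤ i) (W : MIdx → ℕ → ℝ) (hW : ∀ μ, W μ 0 = 1) :
    ∑ s ∈ Finset.Icc 1 (wt β), ∑' kl : Pset s i β, ∏ l, W (kl.1.2 l) (kl.1.1 l) =
      ∑ k ∈ partMultFns i β, ∏ μ ∈ posIdx (wt β), W μ (k μ) := by
  simp only [tsum_Pset W hW]
  exact Finset.sum_fiberwise_of_maps_to (fun k hk => numParts_mem_Icc hi hk) _

end IndexSet

/-- The polynomial with coefficients `c μ / μ!` in the positive degrees up to `N`. -/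
def taylorPoly (N : ℕ) (c : MIdx → ℝ) : MvPolynomial (Fin 3) ℝ :=
  ∑ μ ∈ posIdx N, MvPolynomial.monomial (Finsupp.equivFunOnFinite.symm μ) (c μ / mfact μ)

lemma coeff_taylorPoly (N : ℕ) (c : MIdx → ℝ) (α : Fin 3 →₀ ℕ) :
    (taylorPoly N c).coeff α = if 0 < wt α ∧ wt α ≤ N then c α / mfact α else 0 := by
  classical
  simp only [taylorPoly, MvPolynomial.coeff_sum, MvPolynomial.coeff_monomial,
    Equiv.symm_apply_eq, Finset.sum_ite_eq', mem_posIdx]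
  rfl

lemma coeff_taylorPoly_pow (β : MIdx) (c : MIdx → ℝ) (i : ℕ) :
    (taylorPoly (wt β) c ^ i).coeff (Finsupp.equivFunOnFinite.symm β) =
      i.factorial * ∑ k ∈ partMultFns i β, ∏ μ ∈ posIdx (wt β),
        c μ ^ k μ / ((k μ).factorial * (mfact μ : ℝ) ^ k μ) := by
  classical
  have hmon (k : MIdx → ℕ) : ∏ μ ∈ posIdx (wt β),
      MvPolynomial.monomial (Finsupp.equivFunOnFinite.symm μ) (c μ / mfact μ) ^ k μ =
      MvPolynomial.monomial (Finsupp.equivFunOnFinite.symm (∑ μ ∈ posIdx (wt β), k μ • μ))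
        (∏ μ ∈ posIdx (wt β), (c μ / mfact μ) ^ k μ) := by
    induction posIdx (wt β) using Finset.induction_on with
    | empty =>
      rw [Finset.prod_empty, Finset.prod_empty, Finset.sum_empty, MvPolynomial.one_def]
      congr 2
      ext
      rfl
    | insert μ t hμ ih =>
      rw [Finset.prod_insert hμ, Finset.prod_insert hμ, Finset.sum_insert hμ, ih,
        MvPolynomial.monomial_pow, MvPolynomial.monomial_mul]
      congr 2
      ext
      rfl
  have hprod (k : MIdx → ℕ) : ∏ μ ∈ posIdx (wt β), (c μ / mfact μ) ^ k μ =
      (∏ μ ∈ posIdx (wt β), ((k μ).factorial : ℝ)) * ∏ μ ∈ posIdx (wt β),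
        c μ ^ k μ / ((k μ).factorial * (mfact μ : ℝ) ^ k μ) := by
    rw [← Finset.prod_mul_distrib]
    refine Finset.prod_congr rfl fun μ _ => ?_
    have hμ := mfact_ne_zero μ
    have hk : ((k μ).factorial : ℝ) ≠ 0 := Nat.cast_ne_zero.2 (Nat.factorial_ne_zero (k μ))
    rw [div_pow]
    field_simp
  rw [taylorPoly, Finset.sum_pow_eq_sum_piAntidiag, MvPolynomial.coeff_sum, partMultFns,
    Finset.sum_filter, Finset.mul_sum]
  refine Finset.sum_congr rfl fun k hk => ?_
  rw [hmon, ← map_natCast (MvPolynomial.C (R := ℝ) (σ := Fin 3)), MvPolynomial.coeff_C_mul,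
    MvPolynomial.coeff_monomial]
  simp only [Finsupp.equivFunOnFinite.symm.injective.eq_iff]
  split_ifs
  · have hspec := Nat.multinomial_spec (posIdx (wt β)) k
    rw [(Finset.mem_piAntidiag.1 hk).1] at hspec
    rw [← hspec]
    push_cast
    rw [hprod]
    ring
  · simp

/-- multivariate Faà di Bruno: if `g` is smooth near `x₀`, `h` smooth
near `y₀ = g(x₀)` and `f = h ∘ g`, then for `|β| ≥ 1`,
`∂^β f(x₀) = Σ_{i=1}^{|β|} h^{(i)}(y₀) Σ_{s=1}^{|β|} Σ_{P_s(i,β)} β! ∏_l (∂^{λ_l}g(x₀))^{k_l}/(k_l!(λ_l!)^{k_l})`. -/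
theorem statement5 (g : Vec3 → ℝ) (h : ℝ → ℝ) (x₀ : Vec3)
    (hg : ∃ U ∈ nhds x₀, ContDiffOn ℝ (⊤ : ℕ∞) g U)
    (hh : ∃ V ∈ nhds (g x₀), ContDiffOn ℝ (⊤ : ℕ∞) h V)
    (β : MIdx) (hβ : 1 ≤ wt β) :
    pda β (fun x => h (g x)) x₀ =
      ∑ i ∈ Finset.Icc 1 (wt β), iteratedDeriv i h (g x₀) *
        ∑ s ∈ Finset.Icc 1 (wt β), ∑' kl : Pset s i β,
          (mfact β : ℝ) *
            ∏ l : Fin s, (pda (kl.1.2 l) g x₀) ^ (kl.1.1 l) /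
              ((Nat.factorial (kl.1.1 l) : ℝ) * (mfact (kl.1.2 l) : ℝ) ^ (kl.1.1 l)) := by
  obtain ⟨U, hU, hgU⟩ := hg
  obtain ⟨V, hV, hhV⟩ := hh
  have hg' := hgU.contDiffAt hU
  have hh' := hhV.contDiffAt hV
  set P := taylorPoly (wt β) fun α => pda α g x₀ with hPdef
  have hP0 : P.coeff 0 = 0 := by
    rw [hPdef, coeff_taylorPoly]
    simp [wt]
  have hP : IsTaylorPoly x₀ (wt β) g (MvPolynomial.C (g x₀) + P) := by
    classical
    intro α hα
    rw [MvPolynomial.coeff_add, MvPolynomial.coeff_C, hPdef, coeff_taylorPoly]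
    by_cases h0 : α = 0
    · subst h0
      simp [wt, pda, mfact]
    · have hpos : 0 < wt α := Nat.pos_of_ne_zero fun h => h0 (DFunLike.coe_injective (wt_eq_zero.1 h))
      rw [if_neg (Ne.symm h0), if_pos ⟨hpos, hα⟩, zero_add, mul_div_cancel₀ _ (mfact_ne_zero α)]
  have hcomp := hP.comp hg' hh' hP0 (Finsupp.equivFunOnFinite.symm β) (by simp)
  rw [Finsupp.coe_equivFunOnFinite_symm] at hcomp
  rw [hcomp, MvPolynomial.coeff_sum, Finset.mul_sum, Finset.range_eq_Ico,
    Finset.sum_eq_sum_Ico_succ_bot (Nat.succ_pos _)]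
  have hβ0 : (0 : Fin 3 →₀ ℕ) ≠ Finsupp.equivFunOnFinite.symm β := by
    intro h0
    have : β = 0 := by rw [← Finsupp.coe_equivFunOnFinite_symm β, ← h0]; rfl
    simp [this, wt] at hβ
  rw [pow_zero, mul_one, MvPolynomial.coeff_C, if_neg hβ0, mul_zero, zero_add]
  refine Finset.sum_congr rfl fun i hi => ?_
  have hi1 : 1 ≤ i := (Finset.mem_Icc.1 hi).1
  simp only [tsum_mul_left, ← Finset.mul_sum]
  rw [sum_tsum_Pset hi1 (fun μ n => pda μ g x₀ ^ n / ((n.factorial : ℝ) * (mfact μ : ℝ) ^ n))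
    (fun _ => by simp), MvPolynomial.coeff_C_mul, coeff_taylorPoly_pow]
  have := Nat.factorial_ne_zero i
  field_simp

end
end

section
/- There exists a constant C > 0 with the following property. For all m ∈ ℕ, all j with 1 ≤ j ≤ ⌊m/2⌋, all i, s with 1 ≤ i, s ≤ j, all multi-indices α, β ∈ ℕ₀³ with |α| = m, |β| = j, β ≤ α, and all (k₁,…,k_s; λ₁,…,λ_s) ∈ P_s(i,β), the quantity 𝒞 = binom(α, β) · (i−3)!(m−j−2)! β! / ((m−3)!(m−j+1)) · ∏_{l=1}^s (|λ_l|−1)!^{3k_l/4} (|λ_l|−3)!^{k_l/4} / (k_l! (λ_l!)^{k_l}) satisfies 𝒞 ≤ C · i!/(k₁!⋯k_s!). -/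
open MeasureTheory Finset

noncomputable section

variable {E : Type*} [NormedAddCommGroup E] [NormedSpace ℝ E]

theorem choose_add_mul_factorial_mul_factorial (a b : ℕ) :
    (a + b).choose a * a.factorial * b.factorial = (a + b).factorial := by
  simpa using Nat.choose_mul_factorial_mul_factorial (Nat.le_add_right a b)

theorem choose_mul_choose_le (a b c d : ℕ) :
    a.choose b * c.choose d ≤ (a + c).choose (b + d) := by
  rw [Nat.add_choose_eq]
  exact Finset.single_le_sum (f := fun ij : ℕ × ℕ => a.choose ij.1 * c.choose ij.2)
    (fun _ _ => Nat.zero_le _) (a := (b, d)) (by simp)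

theorem prod_choose_le_choose_wt (α β : MIdx) :
    ∏ c, (α c).choose (β c) ≤ (wt α).choose (wt β) := by
  simp only [wt, Fin.prod_univ_three, Fin.sum_univ_three]
  exact (Nat.mul_le_mul_right _ (choose_mul_choose_le _ _ _ _)).trans
    (choose_mul_choose_le _ _ _ _)

theorem wt_add (α β : MIdx) : wt (α + β) = wt α + wt β := by
  simp [wt, Finset.sum_add_distrib]

theorem mfact_pos (α : MIdx) : 0 < mfact α :=
  Finset.prod_pos fun _ _ => Nat.factorial_pos _

/-- The reciprocal `α! / |α|!` of the multinomial coefficient of `α`. -/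
def invMultinomial (α : MIdx) : ℝ := mfact α / (wt α).factorial

theorem invMultinomial_pos (α : MIdx) : 0 < invMultinomial α := by
  have := mfact_pos α
  unfold invMultinomial
  positivity

theorem invMultinomial_zero : invMultinomial 0 = 1 := by
  simp [invMultinomial, mfact, wt]

theorem invMultinomial_add_le (α β : MIdx) :
    invMultinomial (α + β) ≤ invMultinomial α * invMultinomial β := by
  have hm : mfact (α + β) = (∏ c, ((α + β) c).choose (α c)) * (mfact α * mfact β) := by
    simp only [mfact, ← Finset.prod_mul_distrib]
    refine Finset.prod_congr rfl fun c _ => ?_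
    rw [← mul_assoc, Pi.add_apply, choose_add_mul_factorial_mul_factorial]
  have hw : (wt (α + β)).factorial =
      (wt (α + β)).choose (wt α) * ((wt α).factorial * (wt β).factorial) := by
    rw [wt_add, ← mul_assoc, choose_add_mul_factorial_mul_factorial]
  have key : mfact (α + β) * ((wt α).factorial * (wt β).factorial) ≤
      mfact α * mfact β * (wt (α + β)).factorial := by
    rw [hm, hw]
    calc _ = (∏ c, ((α + β) c).choose (α c)) *
          (mfact α * mfact β * ((wt α).factorial * (wt β).factorial)) := by ring
      _ ≤ (wt (α + β)).choose (wt α) *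
          (mfact α * mfact β * ((wt α).factorial * (wt β).factorial)) :=
        Nat.mul_le_mul_right _ (prod_choose_le_choose_wt _ _)
      _ = _ := by ring
  unfold invMultinomial
  rw [div_mul_div_comm, div_le_div_iff₀ (by positivity) (by positivity)]
  exact_mod_cast key

theorem invMultinomial_nsmul_le (k : ℕ) (α : MIdx) :
    invMultinomial (k • α) ≤ invMultinomial α ^ k := by
  induction k with
  | zero => simp [invMultinomial_zero]
  | succ k ih =>
    rw [succ_nsmul, pow_succ]
    exact (invMultinomial_add_le _ _).trans
      (mul_le_mul_of_nonneg_right ih (invMultinomial_pos α).le)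

theorem invMultinomial_sum_le {ι : Type*} (t : Finset ι) (f : ι → MIdx) :
    invMultinomial (∑ l ∈ t, f l) ≤ ∏ l ∈ t, invMultinomial (f l) := by
  classical
  induction t using Finset.induction_on with
  | empty => simp [invMultinomial_zero]
  | insert a t ha ih =>
    rw [Finset.sum_insert ha, Finset.prod_insert ha]
    exact (invMultinomial_add_le _ _).trans
      (mul_le_mul_of_nonneg_left ih (invMultinomial_pos _).le)

theorem factorial_rpow_mul_le (n k : ℕ) :
    ((n - 1).factorial : ℝ) ^ ((3 * (k : ℝ)) / 4) * ((n - 3).factorial : ℝ) ^ ((k : ℝ) / 4) ≤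
      (n.factorial : ℝ) ^ k := by
  have hn : (0 : ℝ) < n.factorial := by positivity
  have h1 : ((n - 1).factorial : ℝ) ≤ n.factorial := by
    exact_mod_cast Nat.factorial_le (Nat.sub_le _ _)
  have h3 : ((n - 3).factorial : ℝ) ≤ n.factorial := by
    exact_mod_cast Nat.factorial_le (Nat.sub_le _ _)
  calc _ ≤ (n.factorial : ℝ) ^ ((3 * (k : ℝ)) / 4) * (n.factorial : ℝ) ^ ((k : ℝ) / 4) := by
        gcongr
    _ = (n.factorial : ℝ) ^ k := by
        rw [← Real.rpow_add hn, ← Real.rpow_natCast]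
        congr 1
        ring

theorem prod_factorial_rpow_div_le {s : ℕ} (k : Fin s → ℕ) (μ : Fin s → MIdx) :
    ∏ l : Fin s,
        (((wt (μ l) - 1).factorial : ℝ) ^ ((3 * (k l : ℝ)) / 4) *
          ((wt (μ l) - 3).factorial : ℝ) ^ ((k l : ℝ) / 4)) /
        (((k l).factorial : ℝ) * (mfact (μ l) : ℝ) ^ (k l)) ≤
      1 / ((∏ l, ((k l).factorial : ℝ)) * invMultinomial (∑ l, k l • μ l)) := by
  have hprod : invMultinomial (∑ l, k l • μ l) ≤ ∏ l, invMultinomial (μ l) ^ k l :=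
    (invMultinomial_sum_le _ _).trans (Finset.prod_le_prod
      (fun _ _ => (invMultinomial_pos _).le) fun _ _ => invMultinomial_nsmul_le _ _)
  have hpos := invMultinomial_pos (∑ l, k l • μ l)
  calc _ ≤ ∏ l, 1 / (((k l).factorial : ℝ) * invMultinomial (μ l) ^ k l) := by
        refine Finset.prod_le_prod (fun _ _ => by positivity) fun l _ => ?_
        have hm : (0 : ℝ) < mfact (μ l) := by exact_mod_cast mfact_pos (μ l)
        calc _ ≤ ((wt (μ l)).factorial : ℝ) ^ k l /
              (((k l).factorial : ℝ) * (mfact (μ l) : ℝ) ^ (k l)) := by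
              gcongr
              exact factorial_rpow_mul_le _ _
          _ = _ := by
              unfold invMultinomial
              rw [div_pow]
              field_simp
    _ = 1 / ((∏ l, ((k l).factorial : ℝ)) * ∏ l, invMultinomial (μ l) ^ k l) := by
        rw [Finset.prod_div_distrib, Finset.prod_mul_distrib, Finset.prod_const_one]
    _ ≤ _ := by gcongr

theorem factorial_le_pow_three_mul {m : ℕ} (hm : 0 < m) :
    m.factorial ≤ m ^ 3 * (m - 3).factorial := by
  match m with
  | 1 => decide
  | 2 => decide
  | n + 3 =>
    simp only [Nat.factorial_succ, Nat.add_sub_cancel]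
    calc _ = (n + 3) * (n + 2) * (n + 1) * n.factorial := by ring
      _ ≤ _ := Nat.mul_le_mul_right _ (by nlinarith)

theorem pow_three_mul_factorial_le (n : ℕ) :
    n ^ 3 * (n - 2).factorial ≤ 2 * (n + 1).factorial := by
  match n with
  | 0 => simp
  | 1 => simp [Nat.factorial]
  | n + 2 =>
    simp only [Nat.factorial_succ, Nat.add_sub_cancel]
    calc _ ≤ (2 * (n + 3) * (n + 2) * (n + 1)) * n.factorial :=
          Nat.mul_le_mul_right _ (by nlinarith [sq_nonneg n])
      _ = _ := by ring

theorem choose_mul_factorial_le {m j : ℕ} (h0 : 1 ≤ j) (hj : j ≤ m / 2) :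
    m.choose j * (m - j - 2).factorial * j.factorial ≤
      16 * ((m - 3).factorial * (m - j + 1)) := by
  obtain ⟨n, rfl⟩ : ∃ n, m = j + n := ⟨m - j, by omega⟩
  rw [Nat.add_sub_cancel_left]
  refine Nat.le_of_mul_le_mul_right ?_ (Nat.factorial_pos n)
  have h8 : (j + n) ^ 3 ≤ 8 * n ^ 3 :=
    (Nat.pow_le_pow_left (by omega : j + n ≤ 2 * n) 3).trans_eq (by ring)
  calc _ = ((j + n).choose j * j.factorial * n.factorial) * (n - 2).factorial := by ring
    _ = (j + n).factorial * (n - 2).factorial := by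
        rw [choose_add_mul_factorial_mul_factorial]
    _ ≤ (8 * n ^ 3 * (j + n - 3).factorial) * (n - 2).factorial :=
        Nat.mul_le_mul_right _
          ((factorial_le_pow_three_mul (by omega)).trans (Nat.mul_le_mul_right _ h8))
    _ = 8 * (j + n - 3).factorial * (n ^ 3 * (n - 2).factorial) := by ring
    _ ≤ 8 * (j + n - 3).factorial * (2 * (n + 1).factorial) :=
        Nat.mul_le_mul_left _ (pow_three_mul_factorial_le n)
    _ = _ := by rw [Nat.factorial_succ]; ring

/-- there is `C > 0` such that for `1 ≤ j ≤ ⌊m/2⌋`, `1 ≤ i, s ≤ j`,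
`|α| = m`, `|β| = j`, `β ≤ α` and `(k₁,…,k_s; λ₁,…,λ_s) ∈ P_s(i,β)`, the quantity
`𝒞 = binom(α,β)(i−3)!(m−j−2)!β!/((m−3)!(m−j+1)) ∏_l (|λ_l|−1)!^{3k_l/4}(|λ_l|−3)!^{k_l/4}/(k_l!(λ_l!)^{k_l})`
satisfies `𝒞 ≤ C i!/(k₁!⋯k_s!)`. -/
theorem statement13 :
    ∃ C : ℝ, 0 < C ∧ ∀ m j i s : ℕ, 1 ≤ j → j ≤ m / 2 → 1 ≤ i → i ≤ j → 1 ≤ s → s ≤ j →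
      ∀ α β : MIdx, wt α = m → wt β = j → (∀ c, β c ≤ α c) →
      ∀ kl : (Fin s → ℕ) × (Fin s → MIdx), kl ∈ Pset s i β →
        (∏ c, (Nat.choose (α c) (β c) : ℝ)) *
          ((Nat.factorial (i - 3) : ℝ) * (Nat.factorial (m - j - 2) : ℝ) * (mfact β : ℝ)) /
          ((Nat.factorial (m - 3) : ℝ) * ((m - j + 1 : ℕ) : ℝ)) *
          ∏ l : Fin s,
            ((Nat.factorial (wt (kl.2 l) - 1) : ℝ) ^ ((3 * (kl.1 l : ℝ)) / 4) *
              (Nat.factorial (wt (kl.2 l) - 3) : ℝ) ^ ((kl.1 l : ℝ) / 4)) /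
            ((Nat.factorial (kl.1 l) : ℝ) * (mfact (kl.2 l) : ℝ) ^ (kl.1 l))
        ≤ C * (Nat.factorial i : ℝ) / ∏ l : Fin s, (Nat.factorial (kl.1 l) : ℝ) := by
  refine ⟨16, by norm_num, ?_⟩
  rintro m j i s h0 hj - - - - α β rfl rfl - ⟨k, μ⟩ ⟨-, -, -, -, hβ⟩
  dsimp only at hβ ⊢
  have hP := prod_factorial_rpow_div_le k μ
  rw [hβ] at hP
  have hm : (0 : ℝ) < mfact β := by exact_mod_cast mfact_pos β
  have hk : (0 : ℝ) < ∏ l, ((k l).factorial : ℝ) :=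
    Finset.prod_pos fun _ _ => by positivity
  have hi : ((i - 3).factorial : ℝ) ≤ i.factorial := by
    exact_mod_cast Nat.factorial_le (Nat.sub_le _ _)
  have hB : (∏ c, ((α c).choose (β c) : ℝ)) ≤ (wt α).choose (wt β) := by
    exact_mod_cast prod_choose_le_choose_wt α β
  have hC : ((wt α).choose (wt β) : ℝ) * (wt α - wt β - 2).factorial * (wt β).factorial ≤
      16 * ((wt α - 3).factorial * (wt α - wt β + 1 : ℕ)) := by
    exact_mod_cast choose_mul_factorial_le h0 hj
  have hD : (0 : ℝ) < (wt α - 3).factorial * (wt α - wt β + 1 : ℕ) := by positivity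
  calc _ ≤ ((wt α).choose (wt β) : ℝ) *
          (i.factorial * (wt α - wt β - 2).factorial * mfact β) /
          ((wt α - 3).factorial * (wt α - wt β + 1 : ℕ)) *
          (1 / ((∏ l, ((k l).factorial : ℝ)) * invMultinomial β)) := by gcongr
    _ = ((wt α).choose (wt β) * (wt α - wt β - 2).factorial * (wt β).factorial) /
          ((wt α - 3).factorial * (wt α - wt β + 1 : ℕ)) *
          (i.factorial / ∏ l, ((k l).factorial : ℝ)) := by
        unfold invMultinomial
        field_simp
    _ ≤ 16 * (i.factorial / ∏ l, ((k l).factorial : ℝ)) := by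
        gcongr
        exact (div_le_iff₀ hD).mpr hC
    _ = _ := by rw [mul_div_assoc]

end
end
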